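/- arXiv:1702.00929 — 2 statements merged into one kernel-verified Lean document; each statement's English description precedes it below -/
import Mathlib

section
/- For every integer n > 2, define H(x,y) = (y−x)/|y−x|^n − (|x|²y − x)/[x,y]^n for x, y in the open unit ball B^n with x ≠ y. Then sup_{x∈B^n} ∫_{B^n} |H(x,y)| dy = ∫_{B^n} |H(0,y)| dy = ω_{n−1}, where ω_{n−1} = 2π^{n/2}/Γ(n/2). Consequently, the operator ℋ f(x) = (1/((n−2)ω_{n−1})) ∫_{B^n} |H(x,y)| f(y) dy is bounded on L^∞(B^n) with operator norm exactly 1/(n−2). -/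
open Real MeasureTheory
open scoped RealInnerProductSpace

/-- `[x,y] := (|x|²|y|² − 2⟨x,y⟩ + 1)^{1/2}`. -/
noncomputable def mobiusBracket {n : ℕ} (x y : EuclideanSpace ℝ (Fin n)) : ℝ :=
  Real.sqrt (‖x‖ ^ 2 * ‖y‖ ^ 2 - 2 * ⟪x, y⟫ + 1)

/-- The kernel `H(x,y) = (y−x)/|y−x|^n − (|x|²y − x)/[x,y]^n`. -/
noncomputable def kernelH (n : ℕ) (x y : EuclideanSpace ℝ (Fin n)) :
    EuclideanSpace ℝ (Fin n) :=
  (‖y - x‖ ^ n)⁻¹ • (y - x) - (mobiusBracket x y ^ n)⁻¹ • (‖x‖ ^ 2 • y - x)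


/-- Integration in polar coordinates for the lower Lebesgue integral. -/
theorem lintegral_eq_lintegral_toSphere {E : Type*} [NormedAddCommGroup E] [NormedSpace ℝ E]
    [MeasurableSpace E] [BorelSpace E] [FiniteDimensional ℝ E] [Nontrivial E]
    (μ : Measure E) [μ.IsAddHaarMeasure] {f : E → ENNReal} (hf : Measurable f) :
    ∫⁻ w, f w ∂μ = ∫⁻ θ : Metric.sphere (0 : E) 1, (∫⁻ ρ in Set.Ioi (0 : ℝ),
      ENNReal.ofReal (ρ ^ (Module.finrank ℝ E - 1)) * f (ρ • (θ : E))) ∂μ.toSphere := by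
  have hmp := μ.measurePreserving_homeomorphUnitSphereProd
  have hme := (homeomorphUnitSphereProd E).measurableEmbedding
  calc ∫⁻ w, f w ∂μ = ∫⁻ w in ({0}ᶜ : Set E), f w ∂μ := by rw [restrict_compl_singleton]
    _ = ∫⁻ w : ({0}ᶜ : Set E), f w ∂(μ.comap (↑)) :=
      (lintegral_subtype_comap (measurableSet_singleton _).compl f).symm
    _ = ∫⁻ p : Metric.sphere (0 : E) 1 × Set.Ioi (0 : ℝ), f ((p.2 : ℝ) • (p.1 : E))
          ∂μ.toSphere.prod (Measure.volumeIoiPow (Module.finrank ℝ E - 1)) := by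
      rw [← hmp.lintegral_comp_emb hme]
      refine lintegral_congr fun w => ?_
      congr 1
      exact (congrArg Subtype.val ((homeomorphUnitSphereProd E).symm_apply_apply w)).symm
    _ = _ := by
      rw [lintegral_prod _ (by fun_prop)]
      refine lintegral_congr fun θ => ?_
      rw [Measure.volumeIoiPow, lintegral_withDensity_eq_lintegral_mul _ (by fun_prop)
        (by fun_prop)]
      exact lintegral_subtype_comap measurableSet_Ioi
        (fun ρ : ℝ => ENNReal.ofReal (ρ ^ (Module.finrank ℝ E - 1)) * f (ρ • (θ : E)))

/-- For a unit vector `θ`, `A = ‖x‖²` and `s = ⟪x, θ⟫`, the squared bracket `[x, x + ρθ]²` is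
`A ρ² - 2 (1 - A) s ρ + (1 - A)²`; it is at least `ρ²` when `x + ρθ` is in the unit ball. -/
theorem sq_le_bracketSq {A s ρ : ℝ} (hA : A < 1) (h : ρ ^ 2 + 2 * s * ρ ≤ 1 - A) :
    ρ ^ 2 ≤ A * ρ ^ 2 - 2 * (1 - A) * s * ρ + (1 - A) ^ 2 := by
  nlinarith [mul_nonneg (sub_nonneg.2 hA.le) (sub_nonneg.2 h)]

theorem bracketSq_pos {A s ρ : ℝ} (hA : A < 1) (hρ : 0 ≤ ρ) (h : ρ ^ 2 + 2 * s * ρ ≤ 1 - A) :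
    0 < A * ρ ^ 2 - 2 * (1 - A) * s * ρ + (1 - A) ^ 2 := by
  rcases hρ.eq_or_lt with rfl | hρ
  · have : 0 < 1 - A := by linarith
    simpa using pow_pos this 2
  · exact (pow_pos hρ 2).trans_le (sq_le_bracketSq hA h)

theorem sub_half_mul_le_div_bracketSq {A s ρ : ℝ} (hA0 : 0 ≤ A) (hA : A < 1) (hρ : 0 ≤ ρ)
    (h : ρ ^ 2 + 2 * s * ρ ≤ 1 - A) :
    (1 - A) * s - A * ρ / 2 ≤ (1 - A) ^ 2 * s * ((1 - A) - s * ρ) /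
      (A * ρ ^ 2 - 2 * (1 - A) * s * ρ + (1 - A) ^ 2) := by
  rw [le_div_iff₀ (bracketSq_pos hA hρ h)]
  set c := 1 - A with hc
  have hc0 : 0 < c := by linarith
  have h2 : 0 ≤ A ^ 2 * c * (c - 2 * s * ρ) := by
    have : 0 ≤ c - 2 * s * ρ := by nlinarith [sq_nonneg ρ]
    positivity
  have key : 0 ≤ c ^ 2 * s ^ 2 + A * c ^ 2 / 2 + A ^ 2 * ρ ^ 2 / 2 - 2 * A * c * s * ρ := by
    have h3 : 0 ≤ A * c * (c - 2 * s * ρ) := by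
      have : 0 ≤ c - 2 * s * ρ := by nlinarith [sq_nonneg ρ]
      positivity
    nlinarith [sq_nonneg (c * s - A * ρ), sq_nonneg (c * s), sq_nonneg (A * ρ)]
  nlinarith [mul_nonneg hρ key]

/-- The function `ρ + (1 - A) s / n * (ρ / b)ⁿ`, with `b = [x, x + ρθ]`, whose derivative dominates
`ρⁿ⁻¹ ‖H(x, x + ρθ)‖`; here `n = k + 1`. -/
noncomputable def radialPrimitive (k : ℕ) (A s ρ : ℝ) : ℝ :=
  ρ + (1 - A) * s / (k + 1) *
    (ρ / √(A * ρ ^ 2 - 2 * (1 - A) * s * ρ + (1 - A) ^ 2)) ^ (k + 1)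

/-- The derivative of `radialPrimitive`. -/
noncomputable def radialDensity (k : ℕ) (A s ρ : ℝ) : ℝ :=
  1 + ρ ^ k / √(A * ρ ^ 2 - 2 * (1 - A) * s * ρ + (1 - A) ^ 2) ^ (k + 1) *
    ((1 - A) ^ 2 * s * ((1 - A) - s * ρ) / (A * ρ ^ 2 - 2 * (1 - A) * s * ρ + (1 - A) ^ 2))

theorem hasDerivAt_radialPrimitive (k : ℕ) {A s ρ : ℝ}
    (hq : 0 < A * ρ ^ 2 - 2 * (1 - A) * s * ρ + (1 - A) ^ 2) :
    HasDerivAt (radialPrimitive k A s) (radialDensity k A s ρ) ρ := by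
  have h1 : HasDerivAt (fun ρ : ℝ => A * ρ ^ 2 - 2 * (1 - A) * s * ρ + (1 - A) ^ 2)
      (A * (2 * ρ) - 2 * (1 - A) * s) ρ := by
    have := (((hasDerivAt_pow 2 ρ).const_mul A).sub
      ((hasDerivAt_id ρ).const_mul (2 * (1 - A) * s))).add_const ((1 - A) ^ 2)
    simpa using this
  have h2 := h1.sqrt hq.ne'
  have h3 := (hasDerivAt_id ρ).add
    ((((hasDerivAt_id ρ).div h2 (Real.sqrt_pos.2 hq).ne').pow (k + 1)).const_mul
      ((1 - A) * s / (k + 1)))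
  refine h3.congr_deriv ?_
  rw [radialDensity]
  obtain ⟨b, hb, hbq⟩ : ∃ b, 0 < b ∧ b ^ 2 = A * ρ ^ 2 - 2 * (1 - A) * s * ρ + (1 - A) ^ 2 :=
    ⟨_, Real.sqrt_pos.2 hq, Real.sq_sqrt hq.le⟩
  simp only [Pi.div_apply, ← hbq, Real.sqrt_sq hb.le, id, Nat.add_sub_cancel, Nat.cast_add, Nat.cast_one]
  have hk : (k : ℝ) + 1 ≠ 0 := by positivity
  have e : 1 * b - ρ * ((A * (2 * ρ) - 2 * (1 - A) * s) / (2 * b)) =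
      (1 - A) * ((1 - A) - s * ρ) / b := by
    field_simp
    linarith
  rw [e, div_pow]
  field_simp
  ring

theorem setLIntegral_radialDensity_le {k : ℕ} {A s : ℝ} (hA : A < 1)
    (hs : s ^ 2 ≤ A)
    (hnn : ∀ ρ, 0 < ρ → ρ ^ 2 + 2 * s * ρ < 1 - A → 0 ≤ radialDensity k A s ρ) :
    ∫⁻ ρ in Set.Ioo 0 (√(s ^ 2 + (1 - A)) - s), ENNReal.ofReal (radialDensity k A s ρ) ≤
      ENNReal.ofReal (1 - (1 - (1 - A) / (k + 1)) * s) := by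
  set l := √(s ^ 2 + (1 - A)) - s with hl
  have hsq : √(s ^ 2 + (1 - A)) ^ 2 = s ^ 2 + (1 - A) := Real.sq_sqrt (by nlinarith [sq_nonneg s])
  have hroot : l ^ 2 + 2 * s * l = 1 - A := by rw [hl]; linarith
  have hl0 : 0 < l := by
    rw [hl, sub_pos]
    exact Real.lt_sqrt_of_sq_lt (by linarith)
  have hle : ∀ ρ, 0 ≤ ρ → ρ ≤ l → ρ ^ 2 + 2 * s * ρ ≤ 1 - A := by
    intro ρ h0 h1
    have h2 : 0 ≤ l + 2 * s := by nlinarith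
    nlinarith [mul_nonneg (sub_nonneg.2 h1) (by linarith : 0 ≤ ρ + (l + 2 * s))]
  have hlt : ∀ ρ, 0 ≤ ρ → ρ < l → ρ ^ 2 + 2 * s * ρ < 1 - A := by
    intro ρ h0 h1
    have h2 : 0 < l + 2 * s := by nlinarith
    nlinarith [mul_pos (sub_pos.2 h1) (by linarith : 0 < ρ + (l + 2 * s))]
  have hq : ∀ ρ ∈ Set.Icc 0 l, 0 < A * ρ ^ 2 - 2 * (1 - A) * s * ρ + (1 - A) ^ 2 :=
    fun ρ h => bracketSq_pos hA h.1 (hle ρ h.1 h.2)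
  have hcont : ContinuousOn (radialDensity k A s) (Set.Icc 0 l) := by
    unfold radialDensity
    refine continuousOn_const.add (ContinuousOn.mul (ContinuousOn.div (by fun_prop)
      (Continuous.continuousOn (by fun_prop)) fun ρ h => ?_)
      (ContinuousOn.div (by fun_prop) (by fun_prop) fun ρ h => (hq ρ h).ne'))
    exact pow_ne_zero _ (Real.sqrt_pos.2 (hq ρ h)).ne'
  have hint : IntegrableOn (radialDensity k A s) (Set.Ioo 0 l) :=
    (hcont.integrableOn_Icc).mono_set Set.Ioo_subset_Icc_self
  have hval : ∫ ρ in (0 : ℝ)..l, radialDensity k A s ρ = l + (1 - A) * s / (k + 1) := by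
    rw [intervalIntegral.integral_eq_sub_of_hasDerivAt (f := radialPrimitive k A s)
      (fun ρ h => hasDerivAt_radialPrimitive k (hq ρ (by rwa [Set.uIcc_of_le hl0.le] at h)))
      (ContinuousOn.intervalIntegrable (by rwa [Set.uIcc_of_le hl0.le]))]
    have : A * l ^ 2 - 2 * (1 - A) * s * l + (1 - A) ^ 2 = l ^ 2 := by
      linear_combination -(1 - A) * hroot
    simp [radialPrimitive, this, Real.sqrt_sq hl0.le, hl0.ne']
  rw [← ofReal_integral_eq_lintegral_ofReal hint
    ((ae_restrict_mem measurableSet_Ioo).mono fun ρ h => hnn ρ h.1 (hlt ρ h.1.le h.2)),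
    ← integral_Ioc_eq_integral_Ioo, ← intervalIntegral.integral_of_le hl0.le, hval]
  refine ENNReal.ofReal_le_ofReal ?_
  have : √(s ^ 2 + (1 - A)) ≤ 1 := Real.sqrt_le_one.2 (by linarith)
  rw [hl]
  have e : (1 - A) * s / (k + 1) = (1 - A) / (k + 1) * s := by ring
  linarith

/-- The pointwise bound of the kernel along rays issuing from `x`. -/
theorem norm_kernelH_mul_pow_le {k : ℕ} (hk : 1 ≤ k) {x θ : EuclideanSpace ℝ (Fin (k + 1))}
    {ρ : ℝ} (hx : ‖x‖ < 1) (hθ : ‖θ‖ = 1) (hρ : 0 < ρ)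
    (h : ρ ^ 2 + 2 * ⟪x, θ⟫ * ρ ≤ 1 - ‖x‖ ^ 2) :
    ρ ^ k * ‖kernelH (k + 1) x (x + ρ • θ)‖ ≤ radialDensity k (‖x‖ ^ 2) ⟪x, θ⟫ ρ := by
  have hA0 : 0 ≤ ‖x‖ ^ 2 := sq_nonneg _
  have hA : ‖x‖ ^ 2 < 1 := by nlinarith [norm_nonneg x]
  have hq := bracketSq_pos hA hρ.le h
  have hle := sq_le_bracketSq hA h
  have haux := sub_half_mul_le_div_bracketSq hA0 hA hρ.le h
  have hnorm : ‖x + ρ • θ‖ ^ 2 = ‖x‖ ^ 2 + 2 * ρ * ⟪x, θ⟫ + ρ ^ 2 := by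
    rw [norm_add_sq_real, inner_smul_right, norm_smul, hθ, Real.norm_of_nonneg hρ.le]
    ring
  have hb : mobiusBracket x (x + ρ • θ) =
      √(‖x‖ ^ 2 * ρ ^ 2 - 2 * (1 - ‖x‖ ^ 2) * ⟪x, θ⟫ * ρ + (1 - ‖x‖ ^ 2) ^ 2) := by
    rw [mobiusBracket, hnorm, inner_add_right, inner_smul_right, real_inner_self_eq_norm_sq]
    congr 1
    ring
  rw [radialDensity, kernelH, hb]
  set A := ‖x‖ ^ 2 with hAdef
  set s := ⟪x, θ⟫ with hs
  set q := A * ρ ^ 2 - 2 * (1 - A) * s * ρ + (1 - A) ^ 2 with hqdef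
  have hb0 : 0 < √q := Real.sqrt_pos.2 hq
  set t := ρ ^ k / √q ^ (k + 1) with ht
  have ht0 : 0 < t := by positivity
  have htq : t * q ≤ ρ := by
    have hρb : ρ / √q ≤ 1 := (div_le_one hb0).2 (Real.le_sqrt_of_sq_le hle)
    have e : t * q = ρ * (ρ / √q) ^ (k - 1) := by
      obtain ⟨j, rfl⟩ := Nat.exists_eq_add_of_le' hk
      rw [ht, Nat.add_sub_cancel, div_pow]
      nth_rewrite 2 [← Real.sq_sqrt hq.le]
      field_simp
      ring
    rw [e]
    exact mul_le_of_le_one_right hρ.le (pow_le_one₀ (by positivity) hρb)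
  have hvec : ρ ^ k • ((‖x + ρ • θ - x‖ ^ (k + 1))⁻¹ • (x + ρ • θ - x) -
      (√q ^ (k + 1))⁻¹ • (A • (x + ρ • θ) - x)) = θ - t • ((A * ρ) • θ - (1 - A) • x) := by
    have h1 : ‖ρ • θ‖ = ρ := by rw [norm_smul, hθ, Real.norm_of_nonneg hρ.le, mul_one]
    rw [add_sub_cancel_left, h1, smul_sub, smul_smul, smul_smul, smul_smul, ht, div_eq_mul_inv]
    congr 1
    · rw [show ρ ^ k * (ρ ^ (k + 1))⁻¹ * ρ = 1 by rw [pow_succ]; field_simp, one_smul]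
    · module
  have hsq : ‖θ - t • ((A * ρ) • θ - (1 - A) • x)‖ ^ 2 =
      1 - 2 * t * (A * ρ - (1 - A) * s) + t ^ 2 * (A * q) := by
    rw [norm_sub_sq_real, norm_smul, inner_smul_right, inner_sub_right, inner_smul_right,
      inner_smul_right, real_inner_self_eq_norm_sq, hθ, real_inner_comm, ← hs, mul_pow,
      norm_sub_sq_real, norm_smul, norm_smul, inner_smul_left, inner_smul_right, mul_pow, mul_pow,
      hθ, real_inner_comm, ← hs, ← hAdef, Real.norm_eq_abs, Real.norm_eq_abs, Real.norm_eq_abs,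
      sq_abs, sq_abs, sq_abs, hqdef]
    simp only [conj_trivial]
    ring
  have hmul : ρ ^ k * ‖(‖x + ρ • θ - x‖ ^ (k + 1))⁻¹ • (x + ρ • θ - x) -
      (√q ^ (k + 1))⁻¹ • (A • (x + ρ • θ) - x)‖ = ‖θ - t • ((A * ρ) • θ - (1 - A) • x)‖ := by
    rw [← hvec, norm_smul, Real.norm_of_nonneg (by positivity)]
  rw [hmul]
  set N := ‖θ - t • ((A * ρ) • θ - (1 - A) • x)‖ with hN
  have h1 : t * ((1 - A) * s - A * ρ / 2) ≤ _ := mul_le_mul_of_nonneg_left haux ht0.le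
  have h2 : t * A * (t * q) ≤ t * A * ρ := mul_le_mul_of_nonneg_left htq (by positivity)
  nlinarith [sq_nonneg (N - 1)]

theorem measurable_kernelH (n : ℕ) (x : EuclideanSpace ℝ (Fin n)) : Measurable (kernelH n x) := by
  unfold kernelH mobiusBracket
  fun_prop

/-- The integral of `ρᵏ ‖H(x, x + ρθ)‖` along a ray is at most `1` minus an odd function of `θ`. -/
theorem lintegral_ray_le {k : ℕ} (hk : 1 ≤ k) {x θ : EuclideanSpace ℝ (Fin (k + 1))}
    (hx : ‖x‖ < 1) (hθ : ‖θ‖ = 1) :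
    ∫⁻ ρ in Set.Ioi (0 : ℝ), ENNReal.ofReal (ρ ^ k) *
        (Metric.ball 0 1).indicator (fun y => ‖kernelH (k + 1) x y‖ₑ) (x + ρ • θ) ≤
      ENNReal.ofReal (1 - (1 - (1 - ‖x‖ ^ 2) / (k + 1)) * ⟪x, θ⟫) := by
  have hA : ‖x‖ ^ 2 < 1 := by nlinarith [norm_nonneg x]
  have hs : ⟪x, θ⟫ ^ 2 ≤ ‖x‖ ^ 2 := by
    have := abs_real_inner_le_norm x θ
    rw [hθ, mul_one] at this
    exact sq_le_sq' (neg_le_of_abs_le this) (le_of_abs_le this)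
  refine le_trans ?_ (setLIntegral_radialDensity_le (k := k) hA hs fun ρ hρ h =>
    le_trans (by positivity) (norm_kernelH_mul_pow_le hk hx hθ hρ h.le))
  rw [← lintegral_indicator measurableSet_Ioi, ← lintegral_indicator measurableSet_Ioo]
  refine lintegral_mono fun ρ => ?_
  by_cases hρ : 0 < ρ
  · rw [Set.indicator_of_mem (Set.mem_Ioi.2 hρ)]
    by_cases hball : x + ρ • θ ∈ Metric.ball (0 : EuclideanSpace ℝ (Fin (k + 1))) 1
    · have h : ρ ^ 2 + 2 * ⟪x, θ⟫ * ρ < 1 - ‖x‖ ^ 2 := by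
        rw [mem_ball_zero_iff, ← sq_lt_one_iff₀ (norm_nonneg _), norm_add_sq_real,
          inner_smul_right, norm_smul, hθ, Real.norm_of_nonneg hρ.le] at hball
        linarith
      have hl : ρ < √(⟪x, θ⟫ ^ 2 + (1 - ‖x‖ ^ 2)) - ⟪x, θ⟫ := by
        have := Real.lt_sqrt_of_sq_lt
          (show (ρ + ⟪x, θ⟫) ^ 2 < ⟪x, θ⟫ ^ 2 + (1 - ‖x‖ ^ 2) by linarith)
        linarith
      rw [Set.indicator_of_mem hball, Set.indicator_of_mem (Set.mem_Ioo.2 ⟨hρ, hl⟩),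
        ← ofReal_norm, ← ENNReal.ofReal_mul (by positivity)]
      exact ENNReal.ofReal_le_ofReal (norm_kernelH_mul_pow_le hk hx hθ hρ h.le)
    · simp [Set.indicator_of_notMem hball]
  · rw [Set.indicator_of_notMem (by simpa using hρ)]
    exact zero_le

/-- Antipodal rays cancel the odd part of the ray bound. -/
theorem lintegral_enorm_kernelH_le {k : ℕ} (hk : 1 ≤ k) {x : EuclideanSpace ℝ (Fin (k + 1))}
    (hx : ‖x‖ < 1) :
    ∫⁻ y in Metric.ball 0 1, ‖kernelH (k + 1) x y‖ₑ ≤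
      (volume : Measure (EuclideanSpace ℝ (Fin (k + 1)))).toSphere Set.univ := by
  set f : EuclideanSpace ℝ (Fin (k + 1)) → ENNReal := fun w =>
    (Metric.ball 0 1).indicator (fun y => ‖kernelH (k + 1) x y‖ₑ) (x + w) with hf
  have hfm : Measurable f := ((measurable_kernelH (k + 1) x).enorm.indicator
    measurableSet_ball).comp (measurable_const_add x)
  have hfint : ∫⁻ y in Metric.ball 0 1, ‖kernelH (k + 1) x y‖ₑ = ∫⁻ w, f w := by
    rw [← lintegral_indicator measurableSet_ball, hf, lintegral_add_left_eq_self]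
  have hneg : ∫⁻ w, f (-w) = ∫⁻ w, f w :=
    (Measure.measurePreserving_neg volume).lintegral_comp hfm
  have hsum : 2 * ∫⁻ w, f w ≤
      2 * (volume : Measure (EuclideanSpace ℝ (Fin (k + 1)))).toSphere Set.univ := by
    calc 2 * ∫⁻ w, f w = ∫⁻ w, (f w + f (-w)) := by
          rw [lintegral_add_left hfm, hneg, two_mul]
      _ ≤ ∫⁻ _ : Metric.sphere (0 : EuclideanSpace ℝ (Fin (k + 1))) 1, 2
            ∂(volume : Measure (EuclideanSpace ℝ (Fin (k + 1)))).toSphere := by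
          rw [lintegral_eq_lintegral_toSphere _ (by fun_prop)]
          refine lintegral_mono fun θ => ?_
          have hθ : ‖(θ : EuclideanSpace ℝ (Fin (k + 1)))‖ = 1 := by simp
          have h1 := lintegral_ray_le hk hx hθ
          have h2 := lintegral_ray_le hk hx ((norm_neg _).trans hθ)
          have hs := abs_real_inner_le_norm x θ
          rw [hθ, mul_one] at hs
          set s := ⟪x, (θ : EuclideanSpace ℝ (Fin (k + 1)))⟫ with hsdef
          have hd0 : 0 ≤ (1 - ‖x‖ ^ 2) / ((k : ℝ) + 1) :=
            div_nonneg (by nlinarith [norm_nonneg x]) (by positivity)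
          have hd1 : (1 - ‖x‖ ^ 2) / ((k : ℝ) + 1) ≤ 1 := by
            rw [div_le_one (by positivity)]
            nlinarith [norm_nonneg x, (Nat.cast_nonneg k : (0 : ℝ) ≤ k)]
          have hm : |(1 - (1 - ‖x‖ ^ 2) / ((k : ℝ) + 1)) * s| ≤ 1 := by
            rw [abs_mul, abs_of_nonneg (by linarith)]
            exact mul_le_one₀ (by linarith) (abs_nonneg s) (by linarith)
          rw [abs_le] at hm
          simp only [finrank_euclideanSpace, Fintype.card_fin, Nat.add_sub_cancel, mul_add]
          rw [lintegral_add_left (by fun_prop)]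
          calc _ ≤ _ := add_le_add h1 (by simpa only [hf, smul_neg] using h2)
            _ = 2 := by
              rw [inner_neg_right, ← hsdef, ← ENNReal.ofReal_add (by linarith) (by linarith)]
              ring_nf
              simp
      _ = _ := by rw [lintegral_const]
  rw [hfint]
  exact (ENNReal.mul_le_mul_iff_right two_ne_zero ENNReal.ofNat_ne_top).1 hsum

theorem toSphere_real_univ_euclideanSpace (k : ℕ) :
    (volume : Measure (EuclideanSpace ℝ (Fin (k + 1)))).toSphere.real Set.univ =
      2 * π ^ (((k + 1 : ℕ) : ℝ) / 2) / Real.Gamma ((k + 1 : ℕ) / 2) := by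
  have hk : (0 : ℝ) < ((k + 1 : ℕ) : ℝ) := by positivity
  have hG : 0 < Real.Gamma (((k + 1 : ℕ) : ℝ) / 2) := Real.Gamma_pos_of_pos (by positivity)
  rw [Measure.toSphere_real_apply_univ, measureReal_def, EuclideanSpace.volume_ball,
    finrank_euclideanSpace, Fintype.card_fin, ENNReal.ofReal_one, one_pow, one_mul,
    Real.Gamma_add_one (by positivity), ENNReal.toReal_ofReal (by positivity),
    Real.sqrt_eq_rpow, ← Real.rpow_mul_natCast Real.pi_pos.le]
  rw [show 1 / 2 * ((k + 1 : ℕ) : ℝ) = ((k + 1 : ℕ) : ℝ) / 2 by ring]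
  field_simp

theorem norm_kernelH_zero_left (n : ℕ) (y : EuclideanSpace ℝ (Fin n)) :
    ‖kernelH n 0 y‖ = (‖y‖ ^ n)⁻¹ * ‖y‖ := by
  simp [kernelH, norm_smul]

theorem integral_norm_kernelH_zero_left (k : ℕ) :
    ∫ y in Metric.ball (0 : EuclideanSpace ℝ (Fin (k + 1))) 1, ‖kernelH (k + 1) 0 y‖ =
      (volume : Measure (EuclideanSpace ℝ (Fin (k + 1)))).toSphere.real Set.univ := by
  have h : ∀ y, (Metric.ball (0 : EuclideanSpace ℝ (Fin (k + 1))) 1).indicator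
      (fun y => ‖kernelH (k + 1) 0 y‖) y =
      (Set.Iio 1).indicator (fun r : ℝ => (r ^ (k + 1))⁻¹ * r) ‖y‖ := by
    intro y
    by_cases hy : ‖y‖ < 1
    · rw [Set.indicator_of_mem (by simpa using hy), Set.indicator_of_mem (by simpa using hy),
        norm_kernelH_zero_left]
    · rw [Set.indicator_of_notMem (by simpa using hy), Set.indicator_of_notMem (by simpa using hy)]
  have h1 : ∫ r in Set.Ioi (0 : ℝ), r ^ k •
      (Set.Iio 1).indicator (fun r : ℝ => (r ^ (k + 1))⁻¹ * r) r = 1 := by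
    calc _ = ∫ r in Set.Ioi (0 : ℝ), (Set.Ioo (0 : ℝ) 1).indicator (fun _ => (1 : ℝ)) r := by
          refine setIntegral_congr_fun measurableSet_Ioi fun r (hr : 0 < r) => ?_
          by_cases h : r < 1
          · simp only [Set.indicator_of_mem (Set.mem_Iio.2 h),
              Set.indicator_of_mem (Set.mem_Ioo.2 ⟨hr, h⟩), smul_eq_mul, pow_succ]
            field_simp
          · simp [h]
      _ = 1 := by
          rw [setIntegral_indicator measurableSet_Ioo,
            Set.inter_eq_self_of_subset_right Set.Ioo_subset_Ioi_self]
          simp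
  rw [← integral_indicator measurableSet_ball, integral_congr_ae (.of_forall h),
    integral_fun_norm_addHaar volume, finrank_euclideanSpace, Fintype.card_fin, Nat.add_sub_cancel,
    h1, Measure.toSphere_real_apply_univ, finrank_euclideanSpace, Fintype.card_fin]
  simp

theorem integrableOn_norm_kernelH {k : ℕ} (hk : 1 ≤ k) {x : EuclideanSpace ℝ (Fin (k + 1))}
    (hx : ‖x‖ < 1) :
    IntegrableOn (fun y => ‖kernelH (k + 1) x y‖) (Metric.ball 0 1) := by
  refine ⟨(measurable_kernelH (k + 1) x).norm.aestronglyMeasurable, ?_⟩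
  simp only [HasFiniteIntegral, enorm_norm]
  exact (lintegral_enorm_kernelH_le hk hx).trans_lt (measure_lt_top _ _)

theorem integral_norm_kernelH_le {k : ℕ} (hk : 1 ≤ k) {x : EuclideanSpace ℝ (Fin (k + 1))}
    (hx : ‖x‖ < 1) :
    ∫ y in Metric.ball 0 1, ‖kernelH (k + 1) x y‖ ≤
      (volume : Measure (EuclideanSpace ℝ (Fin (k + 1)))).toSphere.real Set.univ := by
  rw [integral_norm_eq_lintegral_enorm (measurable_kernelH (k + 1) x).aestronglyMeasurable]
  exact ENNReal.toReal_mono (measure_ne_top _ _) (lintegral_enorm_kernelH_le hk hx)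

/-- `sup_{x∈B^n} ∫_{B^n} |H(x,y)| dy = ∫_{B^n} |H(0,y)| dy = ω_{n−1} = 2π^{n/2}/Γ(n/2)`;
consequently, the operator `ℋ f(x) = (1/((n−2)ω_{n−1})) ∫_{B^n} |H(x,y)| f(y) dy` is bounded
on `L^∞(B^n)` with operator norm exactly `1/(n−2)`. -/
theorem norm_H_linfty (n : ℕ) (hn : 2 < n) :
    IsGreatest
      ((fun x => ∫ y in Metric.ball (0 : EuclideanSpace ℝ (Fin n)) 1, ‖kernelH n x y‖) ''
        Metric.ball (0 : EuclideanSpace ℝ (Fin n)) 1)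
      (∫ y in Metric.ball (0 : EuclideanSpace ℝ (Fin n)) 1, ‖kernelH n 0 y‖) ∧
    (∫ y in Metric.ball (0 : EuclideanSpace ℝ (Fin n)) 1, ‖kernelH n 0 y‖) =
      2 * π ^ ((n : ℝ) / 2) / Real.Gamma (n / 2) ∧
    IsLeast
      {c : ℝ | 0 ≤ c ∧ ∀ f : EuclideanSpace ℝ (Fin n) → ℝ, Measurable f → ∀ M : ℝ,
        (∀ y, |f y| ≤ M) → ∀ x ∈ Metric.ball (0 : EuclideanSpace ℝ (Fin n)) 1,
          |(((n : ℝ) - 2) * (2 * π ^ ((n : ℝ) / 2) / Real.Gamma (n / 2)))⁻¹ *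
              ∫ y in Metric.ball (0 : EuclideanSpace ℝ (Fin n)) 1, ‖kernelH n x y‖ * f y| ≤
            c * M}
      (1 / ((n : ℝ) - 2)) := by
  obtain ⟨k, rfl⟩ : ∃ k, n = k + 1 := ⟨n - 1, by omega⟩
  have hk : 1 ≤ k := by omega
  have hω := toSphere_real_univ_euclideanSpace k
  have hzero := integral_norm_kernelH_zero_left k
  have h0 : (0 : EuclideanSpace ℝ (Fin (k + 1))) ∈ Metric.ball 0 1 := by simp
  have hle : ∀ x ∈ Metric.ball (0 : EuclideanSpace ℝ (Fin (k + 1))) 1,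
      ∫ y in Metric.ball 0 1, ‖kernelH (k + 1) x y‖ ≤
        2 * π ^ (((k + 1 : ℕ) : ℝ) / 2) / Real.Gamma ((k + 1 : ℕ) / 2) := fun x hx =>
    (integral_norm_kernelH_le hk (mem_ball_zero_iff.1 hx)).trans_eq hω
  have hpos : 0 < 2 * π ^ (((k + 1 : ℕ) : ℝ) / 2) / Real.Gamma ((k + 1 : ℕ) / 2) := by
    have : 0 < Real.Gamma (((k + 1 : ℕ) : ℝ) / 2) := Real.Gamma_pos_of_pos (by positivity)
    positivity
  have hn2 : 0 < ((k + 1 : ℕ) : ℝ) - 2 := by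
    have : (2 : ℝ) < ((k + 1 : ℕ) : ℝ) := by exact_mod_cast hn
    linarith
  rw [hω] at hzero
  rw [hzero]
  set ω := 2 * π ^ (((k + 1 : ℕ) : ℝ) / 2) / Real.Gamma ((k + 1 : ℕ) / 2)
  set d := ((k + 1 : ℕ) : ℝ) - 2
  refine ⟨⟨⟨0, h0, hzero⟩, ?_⟩, rfl, ⟨by positivity, ?_⟩, ?_⟩
  · rintro _ ⟨x, hx, rfl⟩
    exact hle x hx
  · intro f _ M hM x hx
    have hM0 : 0 ≤ M := (abs_nonneg _).trans (hM 0)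
    have hint := integrableOn_norm_kernelH hk (mem_ball_zero_iff.1 hx)
    have hbound : |∫ y in Metric.ball 0 1, ‖kernelH (k + 1) x y‖ * f y| ≤ ω * M := by
      calc |∫ y in Metric.ball 0 1, ‖kernelH (k + 1) x y‖ * f y|
          ≤ ∫ y in Metric.ball 0 1, ‖kernelH (k + 1) x y‖ * M := by
            rw [← Real.norm_eq_abs]
            refine norm_integral_le_of_norm_le (hint.mul_const M) (.of_forall fun y => ?_)
            rw [norm_mul, norm_norm]
            exact mul_le_mul_of_nonneg_left (hM y) (norm_nonneg _)
        _ = (∫ y in Metric.ball 0 1, ‖kernelH (k + 1) x y‖) * M := integral_mul_const _ _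
        _ ≤ ω * M := mul_le_mul_of_nonneg_right (hle x hx) hM0
    rw [abs_mul, abs_of_pos (by positivity)]
    calc (d * ω)⁻¹ * |∫ y in Metric.ball 0 1, ‖kernelH (k + 1) x y‖ * f y|
        ≤ (d * ω)⁻¹ * (ω * M) := mul_le_mul_of_nonneg_left hbound (by positivity)
      _ = 1 / d * M := by field_simp
  · rintro c ⟨_, hc⟩
    have h := hc (fun _ => 1) measurable_const 1 (fun _ => by simp) 0 h0
    simp only [mul_one, hzero] at h
    rw [abs_of_pos (by positivity)] at h
    calc 1 / d = (d * ω)⁻¹ * ω := by field_simp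
      _ ≤ c := h
end

section
/- Let n > 2 be an integer. The operator 𝒩 defined for g ∈ L¹(B^n) by 𝒩g(x) = (1/((n−2)ω_{n−1})) ∫_{B^n} | (x−y)/|x−y|^n − (|y|²x − y)/[x,y]^n | g(y) dy is bounded from L¹(B^n) to L¹(B^n) with operator norm exactly 1/(n−2). -/
open Real MeasureTheory
open scoped RealInnerProductSpace

/-- The kernel `(x−y)/|x−y|^n − (|y|²x − y)/[x,y]^n`. -/
noncomputable def poissonGradKer (n : ℕ) (x y : EuclideanSpace ℝ (Fin n)) :
    EuclideanSpace ℝ (Fin n) :=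
  (‖x - y‖ ^ n)⁻¹ • (x - y) - (mobiusBracket x y ^ n)⁻¹ • (‖y‖ ^ 2 • x - y)


/-- The reciprocal scaling factor of the chord reflection of the unit ball fixing `y`. -/
noncomputable def chordFactor {n : ℕ} (y x : EuclideanSpace ℝ (Fin n)) : ℝ :=
  1 - 2 * ⟪y, x - y⟫ / (1 - ‖y‖ ^ 2)

/-- The projective involution of the unit ball that fixes `y` and maps every chord through `y`
to itself. -/
noncomputable def chordReflection {n : ℕ} (y x : EuclideanSpace ℝ (Fin n)) :
    EuclideanSpace ℝ (Fin n) :=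
  y - (chordFactor y x)⁻¹ • (x - y)

/-- The derivative of the chord reflection. -/
noncomputable def chordReflectionDeriv {n : ℕ} (y x : EuclideanSpace ℝ (Fin n)) :
    EuclideanSpace ℝ (Fin n) →L[ℝ] EuclideanSpace ℝ (Fin n) :=
  (-(chordFactor y x)⁻¹) • (ContinuousLinearMap.id ℝ _ +
    (innerSL ℝ y).smulRight ((2 / (1 - ‖y‖ ^ 2) * (chordFactor y x)⁻¹) • (x - y)))

/-- The odd correction term in the comparison of the kernel with `‖x - y‖ ^ (1 - n)`. -/
noncomputable def oddTerm (n : ℕ) (x y : EuclideanSpace ℝ (Fin n)) : ℝ :=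
  (1 - ‖y‖ ^ 2) * ⟪y, x - y⟫ / (‖x - y‖ * mobiusBracket x y ^ n)

section geometry

variable {n : ℕ} {x y : EuclideanSpace ℝ (Fin n)}

lemma one_sub_norm_sq_pos (hy : ‖y‖ < 1) : 0 < 1 - ‖y‖ ^ 2 := by
  nlinarith [norm_nonneg y]

lemma norm_sq_eq_center_expansion :
    ‖x‖ ^ 2 = ‖x - y‖ ^ 2 + 2 * ⟪y, x - y⟫ + ‖y‖ ^ 2 := by
  have h := norm_add_sq_real (x - y) y
  rw [sub_add_cancel, real_inner_comm] at h
  exact h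

lemma chordFactor_mul (hy : ‖y‖ < 1) :
    (1 - ‖y‖ ^ 2) * chordFactor y x = 1 - ‖y‖ ^ 2 - 2 * ⟪y, x - y⟫ := by
  have := (one_sub_norm_sq_pos hy).ne'
  unfold chordFactor
  field_simp

lemma chordFactor_pos (hx : ‖x‖ < 1) (hy : ‖y‖ < 1) : 0 < chordFactor y x := by
  have hd := one_sub_norm_sq_pos hy
  have h1 := chordFactor_mul (x := x) hy
  have h2 := norm_sq_eq_center_expansion (x := x) (y := y)
  have h3 := one_sub_norm_sq_pos hx
  nlinarith [sq_nonneg ‖x - y‖]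

lemma chordReflection_sub : chordReflection y x - y = -(chordFactor y x)⁻¹ • (x - y) := by
  simp [chordReflection]

lemma inner_chordReflection_sub :
    ⟪y, chordReflection y x - y⟫ = -(chordFactor y x)⁻¹ * ⟪y, x - y⟫ := by
  rw [chordReflection_sub, inner_smul_right]

lemma norm_chordReflection_sub (hx : ‖x‖ < 1) (hy : ‖y‖ < 1) :
    ‖chordReflection y x - y‖ = (chordFactor y x)⁻¹ * ‖x - y‖ := by
  rw [chordReflection_sub, norm_smul, norm_neg, norm_inv, Real.norm_eq_abs,
    abs_of_pos (chordFactor_pos hx hy)]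

lemma chordFactor_chordReflection (hx : ‖x‖ < 1) (hy : ‖y‖ < 1) :
    chordFactor y (chordReflection y x) = (chordFactor y x)⁻¹ := by
  have hd := (one_sub_norm_sq_pos hy).ne'
  have hk := (chordFactor_pos hx hy).ne'
  have h1 := chordFactor_mul (x := x) hy
  have h2 := chordFactor_mul (x := chordReflection y x) hy
  rw [inner_chordReflection_sub] at h2
  have h3 : 2 * ⟪y, x - y⟫ = (1 - ‖y‖ ^ 2) * (1 - chordFactor y x) := by linarith
  apply mul_left_cancel₀ hd
  rw [h2]
  field_simp
  linarith

lemma chordReflection_chordReflection (hx : ‖x‖ < 1) (hy : ‖y‖ < 1) :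
    chordReflection y (chordReflection y x) = x := by
  have hk := (chordFactor_pos hx hy).ne'
  rw [chordReflection, chordFactor_chordReflection hx hy, chordReflection_sub, smul_smul, inv_inv,
    mul_neg, mul_inv_cancel₀ hk]
  simp

lemma norm_chordReflection_lt_one (hx : ‖x‖ < 1) (hy : ‖y‖ < 1) :
    ‖chordReflection y x‖ < 1 := by
  have hk := chordFactor_pos hx hy
  have h1 := chordFactor_mul (x := x) hy
  have h2 := norm_sq_eq_center_expansion (x := x) (y := y)
  have h3 := norm_sq_eq_center_expansion (x := chordReflection y x) (y := y)
  rw [inner_chordReflection_sub, norm_chordReflection_sub hx hy] at h3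
  have h4 := one_sub_norm_sq_pos hx
  have h5 : 1 - ‖chordReflection y x‖ ^ 2 = ((chordFactor y x)⁻¹) ^ 2 * (1 - ‖x‖ ^ 2) := by
    have h6 : 2 * ⟪y, x - y⟫ = (1 - ‖y‖ ^ 2) * (1 - chordFactor y x) := by linarith
    have h7 : 1 - ‖chordReflection y x‖ ^ 2 = 1 - ‖y‖ ^ 2 - ((chordFactor y x)⁻¹) ^ 2 * ‖x - y‖ ^ 2
        + (chordFactor y x)⁻¹ * (2 * ⟪y, x - y⟫) := by rw [h3]; ring
    have h8 : 1 - ‖x‖ ^ 2 = 1 - ‖y‖ ^ 2 - ‖x - y‖ ^ 2 - 2 * ⟪y, x - y⟫ := by rw [h2]; ring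
    rw [h7, h8, h6]
    field_simp
    ring
  have h6 : 0 < 1 - ‖chordReflection y x‖ ^ 2 := by rw [h5]; positivity
  nlinarith [norm_nonneg (chordReflection y x)]

lemma image_chordReflection_ball (hy : ‖y‖ < 1) :
    chordReflection y '' Metric.ball 0 1 = Metric.ball 0 1 := by
  ext x
  simp only [Set.mem_image, mem_ball_zero_iff]
  refine ⟨?_, fun hx ↦ ⟨_, norm_chordReflection_lt_one hx hy, chordReflection_chordReflection hx hy⟩⟩
  rintro ⟨z, hz, rfl⟩
  exact norm_chordReflection_lt_one hz hy

lemma injOn_chordReflection_ball (hy : ‖y‖ < 1) :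
    Set.InjOn (chordReflection y) (Metric.ball 0 1) := by
  intro a ha b hb hab
  rw [mem_ball_zero_iff] at ha hb
  rw [← chordReflection_chordReflection ha hy, hab, chordReflection_chordReflection hb hy]

lemma hasFDerivAt_chordReflection (hx : ‖x‖ < 1) (hy : ‖y‖ < 1) :
    HasFDerivAt (chordReflection y) (chordReflectionDeriv y x) x := by
  have hk := (chordFactor_pos hx hy).ne'
  have h0 : HasFDerivAt (fun z : EuclideanSpace ℝ (Fin n) ↦ z - y)
      (ContinuousLinearMap.id ℝ _) x := (hasFDerivAt_id x).sub_const y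
  have h1 : HasFDerivAt (fun z ↦ ⟪y, z - y⟫) (innerSL ℝ y) x := by
    have := (innerSL ℝ y).hasFDerivAt.comp x h0
    simpa [Function.comp_def] using this
  have h2 : HasFDerivAt (chordFactor y) (-((2 / (1 - ‖y‖ ^ 2)) • innerSL ℝ y)) x := by
    have := (h1.const_mul (2 / (1 - ‖y‖ ^ 2))).const_sub 1
    refine this.congr_of_eventuallyEq (.of_forall fun z ↦ ?_)
    simp only [chordFactor]
    ring
  have h3 := (((hasDerivAt_inv hk).comp_hasFDerivAt x h2).smul h0).const_sub y
  refine h3.congr_fderiv ?_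
  ext1 v
  simp only [chordReflectionDeriv, Function.comp_apply, neg_apply, add_apply, smul_apply,
    ContinuousLinearMap.smulRight_apply, ContinuousLinearMap.id_apply,
    innerSL_apply_apply, smul_eq_mul, smul_add, smul_smul, neg_add, neg_smul]
  congr 2
  rw [← neg_smul]
  congr 1
  field_simp

lemma abs_det_chordReflectionDeriv (hx : ‖x‖ < 1) (hy : ‖y‖ < 1) :
    |(chordReflectionDeriv y x).det| = ((chordFactor y x)⁻¹) ^ (n + 1) := by
  have hk := chordFactor_pos hx hy
  have hd := (one_sub_norm_sq_pos hy).ne'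
  have h : (chordReflectionDeriv y x : EuclideanSpace ℝ (Fin n) →ₗ[ℝ] EuclideanSpace ℝ (Fin n)) =
      (-(chordFactor y x)⁻¹) • LinearMap.transvection (innerSL ℝ y).toLinearMap
        ((2 / (1 - ‖y‖ ^ 2) * (chordFactor y x)⁻¹) • (x - y)) := by
    ext1 v
    simp [chordReflectionDeriv, LinearMap.transvection.apply, add_comm]
  have h1 := chordFactor_mul (x := x) hy
  have h2 : 1 + 2 / (1 - ‖y‖ ^ 2) * (chordFactor y x)⁻¹ * ⟪y, x - y⟫ = (chordFactor y x)⁻¹ := by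
    field_simp
    linarith
  rw [ContinuousLinearMap.det, h, LinearMap.det_smul, LinearMap.transvection.det]
  simp only [ContinuousLinearMap.coe_coe, innerSL_apply_apply, inner_smul_right, h2]
  rw [finrank_euclideanSpace_fin, abs_mul, abs_pow, abs_neg, abs_of_pos (inv_pos.2 hk), pow_succ]

lemma mobiusBracket_arg_nonneg : 0 ≤ ‖x‖ ^ 2 * ‖y‖ ^ 2 - 2 * ⟪x, y⟫ + 1 := by
  nlinarith [real_inner_le_norm x y, sq_nonneg (‖x‖ * ‖y‖ - 1)]

lemma mobiusBracket_sq : mobiusBracket x y ^ 2 = ‖x‖ ^ 2 * ‖y‖ ^ 2 - 2 * ⟪x, y⟫ + 1 :=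
  Real.sq_sqrt mobiusBracket_arg_nonneg

lemma mobiusBracket_nonneg : 0 ≤ mobiusBracket x y := Real.sqrt_nonneg _

lemma mobiusBracket_sq_eq_center_expansion :
    mobiusBracket x y ^ 2 =
      (1 - ‖y‖ ^ 2) ^ 2 - 2 * (1 - ‖y‖ ^ 2) * ⟪y, x - y⟫ + ‖y‖ ^ 2 * ‖x - y‖ ^ 2 := by
  have h2 := norm_sq_eq_center_expansion (x := x) (y := y)
  have h3 : ⟪x, y⟫ = ⟪y, x - y⟫ + ‖y‖ ^ 2 := by
    rw [inner_sub_right, real_inner_self_eq_norm_sq, real_inner_comm]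
    ring
  rw [mobiusBracket_sq, h2, h3]
  ring

lemma one_sub_norm_le_mobiusBracket (hx : ‖x‖ < 1) : 1 - ‖y‖ ≤ mobiusBracket x y := by
  by_cases hy : ‖y‖ < 1
  · refine Real.le_sqrt_of_sq_le ?_
    have h : (1 - ‖x‖ * ‖y‖) ^ 2 ≤ ‖x‖ ^ 2 * ‖y‖ ^ 2 - 2 * ⟪x, y⟫ + 1 := by
      nlinarith [real_inner_le_norm x y]
    refine le_trans ?_ h
    have : ‖x‖ * ‖y‖ ≤ ‖y‖ := by nlinarith [norm_nonneg y]
    gcongr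
  · exact le_trans (by linarith) mobiusBracket_nonneg

lemma mobiusBracket_pos (hx : ‖x‖ < 1) (hy : ‖y‖ < 1) : 0 < mobiusBracket x y :=
  lt_of_lt_of_le (by linarith) (one_sub_norm_le_mobiusBracket hx)

lemma norm_sub_le_mobiusBracket (hx : ‖x‖ < 1) (hy : ‖y‖ < 1) :
    ‖x - y‖ ≤ mobiusBracket x y := by
  refine Real.le_sqrt_of_sq_le ?_
  rw [norm_sub_sq_real]
  nlinarith [mul_pos (one_sub_norm_sq_pos hx) (one_sub_norm_sq_pos hy)]

lemma mobiusBracket_chordReflection (hx : ‖x‖ < 1) (hy : ‖y‖ < 1) :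
    mobiusBracket (chordReflection y x) y = (chordFactor y x)⁻¹ * mobiusBracket x y := by
  have hk := chordFactor_pos hx hy
  rw [← sq_eq_sq₀ mobiusBracket_nonneg (mul_nonneg (inv_pos.2 hk).le mobiusBracket_nonneg), mul_pow,
    mobiusBracket_sq_eq_center_expansion, mobiusBracket_sq_eq_center_expansion,
    inner_chordReflection_sub, norm_chordReflection_sub hx hy]
  have h1 := chordFactor_mul (x := x) hy
  have h6 : ⟪y, x - y⟫ = (1 - ‖y‖ ^ 2) * (1 - chordFactor y x) / 2 := by linarith
  rw [h6]
  field_simp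
  ring

lemma oddTerm_chordReflection (hx : ‖x‖ < 1) (hy : ‖y‖ < 1) :
    ((chordFactor y x)⁻¹) ^ (n + 1) * oddTerm n (chordReflection y x) y =
      -((chordFactor y x)⁻¹ * oddTerm n x y) := by
  have hk := (chordFactor_pos hx hy).ne'
  have hb := (mobiusBracket_pos hx hy).ne'
  unfold oddTerm
  rw [inner_chordReflection_sub, norm_chordReflection_sub hx hy, mobiusBracket_chordReflection hx hy]
  by_cases hs : ‖x - y‖ = 0
  · simp [hs]
  rw [mul_pow, inv_pow, inv_pow, pow_succ]
  field_simp

lemma norm_poissonGradKer_sq :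
    ‖poissonGradKer n x y‖ ^ 2 = ((‖x - y‖ ^ n)⁻¹) ^ 2 * ‖x - y‖ ^ 2
      + ((mobiusBracket x y ^ n)⁻¹) ^ 2 * (‖y‖ ^ 2 * mobiusBracket x y ^ 2)
      - (‖x - y‖ ^ n)⁻¹ * (mobiusBracket x y ^ n)⁻¹ *
        (mobiusBracket x y ^ 2 + ‖y‖ ^ 2 * ‖x - y‖ ^ 2 - (1 - ‖y‖ ^ 2) ^ 2) := by
  rw [poissonGradKer, norm_sub_sq_real, norm_smul, norm_smul, inner_smul_left, inner_smul_right,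
    mul_pow, mul_pow, mobiusBracket_sq_eq_center_expansion]
  have h1 : ‖y‖ ^ 2 • x - y = ‖y‖ ^ 2 • (x - y) - (1 - ‖y‖ ^ 2) • y := by
    simp only [smul_sub, sub_smul, one_smul]
    abel
  have h2 : ⟪x - y, ‖y‖ ^ 2 • x - y⟫ = ‖y‖ ^ 2 * ‖x - y‖ ^ 2 - (1 - ‖y‖ ^ 2) * ⟪y, x - y⟫ := by
    rw [h1, inner_sub_right, inner_smul_right, inner_smul_right, real_inner_self_eq_norm_sq,
      real_inner_comm]
  have h3 : ‖‖y‖ ^ 2 • x - y‖ ^ 2 = ‖y‖ ^ 2 * ((1 - ‖y‖ ^ 2) ^ 2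
      - 2 * (1 - ‖y‖ ^ 2) * ⟪y, x - y⟫ + ‖y‖ ^ 2 * ‖x - y‖ ^ 2) := by
    rw [h1, norm_sub_sq_real, norm_smul, norm_smul, inner_smul_left, inner_smul_right, mul_pow,
      mul_pow, real_inner_comm]
    simp
    ring
  rw [h2, h3, norm_inv, norm_inv, norm_pow, norm_pow, norm_norm,
    Real.norm_of_nonneg mobiusBracket_nonneg]
  simp only [conj_trivial]
  ring

end geometry

section kernel_estimates

variable {n : ℕ} {x y : EuclideanSpace ℝ (Fin n)}

lemma inv_pow_mul_sq_antitone (hn : 2 < n) {s b : ℝ} (hs : 0 < s) (hsb : s ≤ b) :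
    (b ^ n)⁻¹ * b ^ 2 ≤ (s ^ n)⁻¹ * s ^ 2 := by
  obtain ⟨m, rfl⟩ := Nat.exists_eq_add_of_lt hn
  have hb : 0 < b := hs.trans_le hsb
  have key (t : ℝ) (ht : 0 < t) : (t ^ (2 + m + 1))⁻¹ * t ^ 2 = (t ^ (m + 1))⁻¹ := by
    rw [add_assoc, pow_add]
    field_simp
  rw [key _ hs, key _ hb]
  gcongr

lemma norm_poissonGradKer_le (hn : 2 < n) (hxy : x ≠ y) (hx : ‖x‖ < 1) (hy : ‖y‖ < 1) :
    ‖poissonGradKer n x y‖ ≤ (‖x - y‖ ^ n)⁻¹ * ‖x - y‖ + oddTerm n x y := by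
  have hs : 0 < ‖x - y‖ := norm_pos_iff.2 (sub_ne_zero.2 hxy)
  have hb := mobiusBracket_pos hx hy
  have hmono := inv_pow_mul_sq_antitone hn hs (norm_sub_le_mobiusBracket hx hy)
  have hsq := norm_poissonGradKer_sq (x := x) (y := y)
  have hexp := mobiusBracket_sq_eq_center_expansion (x := x) (y := y)
  set A := (‖x - y‖ ^ n)⁻¹ * ‖x - y‖ with hA
  set h := oddTerm n x y with hh
  have hApos : 0 < A := by positivity
  have hAh : 2 * A * h = (‖x - y‖ ^ n)⁻¹ * (mobiusBracket x y ^ n)⁻¹ *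
      (2 * (1 - ‖y‖ ^ 2) * ⟪y, x - y⟫) := by
    rw [hA, hh, oddTerm]
    field_simp
  have hle : ‖poissonGradKer n x y‖ ^ 2 ≤ A ^ 2 + 2 * A * h := by
    have h1 : (mobiusBracket x y ^ n)⁻¹ * ‖y‖ ^ 2 *
        ((mobiusBracket x y ^ n)⁻¹ * mobiusBracket x y ^ 2) ≤
        (mobiusBracket x y ^ n)⁻¹ * ‖y‖ ^ 2 * ((‖x - y‖ ^ n)⁻¹ * ‖x - y‖ ^ 2) := by
      gcongr
    have h2 : 0 ≤ (mobiusBracket x y ^ n)⁻¹ * ‖y‖ ^ 2 * ((‖x - y‖ ^ n)⁻¹ * ‖x - y‖ ^ 2) := by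
      positivity
    have h3 : 2 * (1 - ‖y‖ ^ 2) * ⟪y, x - y⟫ =
        (1 - ‖y‖ ^ 2) ^ 2 + ‖y‖ ^ 2 * ‖x - y‖ ^ 2 - mobiusBracket x y ^ 2 := by linarith
    rw [hsq, hAh, h3, hA]
    generalize (‖x - y‖ ^ n)⁻¹ = P at *
    generalize (mobiusBracket x y ^ n)⁻¹ = Q at *
    linarith
  have hnn : 0 ≤ A + 2 * h := by
    have : 0 ≤ A * (A + 2 * h) := by nlinarith [sq_nonneg ‖poissonGradKer n x y‖]
    exact nonneg_of_mul_nonneg_right this hApos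
  refine le_of_sq_le_sq ?_ (by linarith)
  nlinarith [sq_nonneg h]

lemma norm_norm_sq_smul_sub : ‖‖y‖ ^ 2 • x - y‖ = ‖y‖ * mobiusBracket x y := by
  rw [← sq_eq_sq₀ (norm_nonneg _) (mul_nonneg (norm_nonneg _) mobiusBracket_nonneg),
    norm_sub_sq_real, norm_smul, inner_smul_left, mul_pow, mul_pow, mobiusBracket_sq]
  simp
  ring

lemma le_norm_poissonGradKer (hx : ‖x‖ < 1) (hy : ‖y‖ < 1) :
    (‖x - y‖ ^ n)⁻¹ * ‖x - y‖ - ((1 - ‖y‖) ^ n)⁻¹ * (2 * ‖y‖) ≤ ‖poissonGradKer n x y‖ := by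
  have hr : 0 < 1 - ‖y‖ := by linarith
  have hb := mobiusBracket_pos hx hy
  have hb2 : mobiusBracket x y ≤ 2 := by
    refine Real.sqrt_le_iff.2 ⟨by norm_num, ?_⟩
    have h1 : ‖x‖ * ‖y‖ ≤ 1 := by nlinarith [norm_nonneg x, norm_nonneg y]
    nlinarith [neg_le_of_abs_le (abs_real_inner_le_norm x y),
      mul_nonneg (norm_nonneg x) (norm_nonneg y)]
  have h2 : ‖(mobiusBracket x y ^ n)⁻¹ • (‖y‖ ^ 2 • x - y)‖ ≤ ((1 - ‖y‖) ^ n)⁻¹ * (2 * ‖y‖) := by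
    rw [norm_smul, norm_norm_sq_smul_sub, Real.norm_of_nonneg (by positivity),
      mul_comm (‖y‖) (mobiusBracket x y)]
    gcongr
    exact one_sub_norm_le_mobiusBracket hx
  have h3 : ‖(‖x - y‖ ^ n)⁻¹ • (x - y)‖ = (‖x - y‖ ^ n)⁻¹ * ‖x - y‖ := by
    rw [norm_smul, Real.norm_of_nonneg (by positivity)]
  rw [poissonGradKer]
  have := norm_sub_norm_le ((‖x - y‖ ^ n)⁻¹ • (x - y))
    ((mobiusBracket x y ^ n)⁻¹ • (‖y‖ ^ 2 • x - y))
  linarith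

lemma abs_oddTerm_le (hx : ‖x‖ < 1) (hy : ‖y‖ < 1) :
    |oddTerm n x y| ≤ ((1 - ‖y‖) ^ n)⁻¹ := by
  have hr : 0 < 1 - ‖y‖ := by linarith
  have hb := mobiusBracket_pos hx hy
  have hd := one_sub_norm_sq_pos hy
  by_cases hs : ‖x - y‖ = 0
  · simp only [oddTerm, hs]
    simp
    positivity
  have hs' : 0 < ‖x - y‖ := lt_of_le_of_ne (norm_nonneg _) (Ne.symm hs)
  rw [oddTerm, abs_div, abs_mul, abs_of_pos hd, abs_of_pos (by positivity : 0 < ‖x - y‖ * _)]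
  have h1 : (1 - ‖y‖ ^ 2) * |⟪y, x - y⟫| ≤ ‖x - y‖ := by
    have := abs_real_inner_le_norm y (x - y)
    have h2 : ‖y‖ * ‖x - y‖ ≤ 1 * ‖x - y‖ := by gcongr
    have h3 : (1 - ‖y‖ ^ 2) * |⟪y, x - y⟫| ≤ 1 * ‖x - y‖ := by
      gcongr
      · nlinarith [sq_nonneg ‖y‖]
      · linarith
    linarith
  calc _ ≤ ‖x - y‖ / (‖x - y‖ * mobiusBracket x y ^ n) := by gcongr
    _ = (mobiusBracket x y ^ n)⁻¹ := by field_simp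
    _ ≤ _ := by
      gcongr
      exact one_sub_norm_le_mobiusBracket hx

lemma oddTerm_le_inv_chordFactor_mul (hx : ‖x‖ < 1) (hy : ‖y‖ < 1) :
    oddTerm n x y ≤ (chordFactor y x)⁻¹ * oddTerm n x y := by
  have hk := chordFactor_pos hx hy
  have hb := mobiusBracket_pos hx hy
  have hd := one_sub_norm_sq_pos hy
  have h1 := chordFactor_mul (x := x) hy
  rcases le_total 0 ⟪y, x - y⟫ with hp | hp
  · refine le_mul_of_one_le_left (by unfold oddTerm; positivity) ((one_le_inv₀ hk).2 ?_)
    nlinarith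
  · have h2 : oddTerm n x y ≤ 0 :=
      div_nonpos_of_nonpos_of_nonneg (mul_nonpos_of_nonneg_of_nonpos hd.le hp) (by positivity)
    have h3 : (chordFactor y x)⁻¹ ≤ 1 := inv_le_one_of_one_le₀ (by nlinarith)
    nlinarith

end kernel_estimates

section integral_estimates

variable {n : ℕ} {y : EuclideanSpace ℝ (Fin n)}

@[fun_prop]
lemma measurable_mobiusBracket :
    Measurable fun p : EuclideanSpace ℝ (Fin n) × EuclideanSpace ℝ (Fin n) ↦
      mobiusBracket p.1 p.2 := by
  unfold mobiusBracket
  fun_prop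

lemma measurable_poissonGradKer :
    Measurable fun p : EuclideanSpace ℝ (Fin n) × EuclideanSpace ℝ (Fin n) ↦
      poissonGradKer n p.1 p.2 := by
  unfold poissonGradKer
  fun_prop

lemma integrableOn_oddTerm (hy : ‖y‖ < 1) :
    IntegrableOn (fun x ↦ oddTerm n x y) (Metric.ball 0 1) := by
  refine Measure.integrableOn_of_bounded (M := ((1 - ‖y‖) ^ n)⁻¹) measure_ball_lt_top.ne ?_ ?_
  · have : Measurable fun x ↦ mobiusBracket x y :=
      Measurable.of_uncurry_right (f := mobiusBracket) measurable_mobiusBracket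
    have hinner : Measurable fun x : EuclideanSpace ℝ (Fin n) ↦ ⟪y, x - y⟫ := by fun_prop
    have hnorm : Measurable fun x : EuclideanSpace ℝ (Fin n) ↦ ‖x - y‖ := by fun_prop
    exact ((hinner.const_mul _).div (hnorm.mul (this.pow_const n))).aestronglyMeasurable
  · filter_upwards [ae_restrict_mem measurableSet_ball] with x hx
    exact abs_oddTerm_le (mem_ball_zero_iff.1 hx) hy

lemma setIntegral_oddTerm_nonpos (hy : ‖y‖ < 1) :
    ∫ x in Metric.ball 0 1, oddTerm n x y ≤ 0 := by
  have hderiv : ∀ x ∈ Metric.ball (0 : EuclideanSpace ℝ (Fin n)) 1,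
      HasFDerivWithinAt (chordReflection y) (chordReflectionDeriv y x) (Metric.ball 0 1) x :=
    fun x hx ↦ (hasFDerivAt_chordReflection (mem_ball_zero_iff.1 hx) hy).hasFDerivWithinAt
  have hcongr : ∀ x ∈ Metric.ball (0 : EuclideanSpace ℝ (Fin n)) 1,
      |(chordReflectionDeriv y x).det| • oddTerm n (chordReflection y x) y =
        -((chordFactor y x)⁻¹ * oddTerm n x y) := fun x hx ↦ by
    rw [abs_det_chordReflectionDeriv (mem_ball_zero_iff.1 hx) hy, smul_eq_mul,
      oddTerm_chordReflection (mem_ball_zero_iff.1 hx) hy]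
  have hint := (integrableOn_image_iff_integrableOn_abs_det_fderiv_smul volume measurableSet_ball
    hderiv (injOn_chordReflection_ball hy) (fun x ↦ oddTerm n x y)).1
    (by rw [image_chordReflection_ball hy]; exact integrableOn_oddTerm hy)
  have heq := integral_image_eq_integral_abs_det_fderiv_smul volume measurableSet_ball
    hderiv (injOn_chordReflection_ball hy) (fun x ↦ oddTerm n x y)
  rw [image_chordReflection_ball hy, setIntegral_congr_fun measurableSet_ball hcongr,
    integral_neg] at heq
  rw [integrableOn_congr_fun hcongr measurableSet_ball] at hint
  have hmono := setIntegral_mono_on (integrableOn_oddTerm hy) (by simpa using hint.neg)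
    measurableSet_ball
    fun x hx ↦ oddTerm_le_inv_chordFactor_mul (n := n) (mem_ball_zero_iff.1 hx) hy
  linarith

lemma integrableOn_Ioo_pow_pred_mul (hn : 0 < n) (R : ℝ) :
    IntegrableOn (fun t : ℝ ↦ t ^ (n - 1) • ((t ^ n)⁻¹ * t)) (Set.Ioo 0 R) := by
  refine (integrableOn_const (C := (1 : ℝ)) (by simp)).congr_fun (fun t ht ↦ ?_) measurableSet_Ioo
  obtain ⟨m, rfl⟩ := Nat.exists_eq_succ_of_ne_zero hn.ne'
  have := ht.1
  simp only [Nat.succ_eq_add_one, Nat.add_sub_cancel, smul_eq_mul, pow_succ]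
  field_simp

lemma integrableOn_ball_riesz (hn : 0 < n) (y : EuclideanSpace ℝ (Fin n)) (R : ℝ) :
    IntegrableOn (fun x ↦ (‖x - y‖ ^ n)⁻¹ * ‖x - y‖) (Metric.ball y R) := by
  have : Nonempty (Fin n) := ⟨⟨0, hn⟩⟩
  have h := (integrableOn_fun_norm_addHaar (volume : Measure (EuclideanSpace ℝ (Fin n)))
    (f := fun t ↦ (t ^ n)⁻¹ * t) (r := R)).2 (by
      rw [finrank_euclideanSpace_fin]; exact integrableOn_Ioo_pow_pred_mul hn R)
  have h2 := ((measurePreserving_sub_right volume y).integrableOn_comp_preimage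
    (MeasurableEquiv.subRight y).measurableEmbedding).2 h
  convert! h2 using 1
  ext x
  simp [dist_eq_norm]

lemma nat_mul_volume_real_unitBall (hn : 0 < n) :
    n * volume.real (Metric.ball (0 : EuclideanSpace ℝ (Fin n)) 1) =
      2 * π ^ ((n : ℝ) / 2) / Real.Gamma (n / 2) := by
  have : Nonempty (Fin n) := ⟨⟨0, hn⟩⟩
  have hn' : (0 : ℝ) < n := by exact_mod_cast hn
  have hG := Real.Gamma_pos_of_pos (half_pos hn')
  rw [Measure.real, EuclideanSpace.volume_ball]
  simp only [Fintype.card_fin, ENNReal.ofReal_one, one_pow, one_mul]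
  rw [Real.Gamma_add_one (by positivity), ENNReal.toReal_ofReal (by positivity),
    Real.sqrt_eq_rpow, ← Real.rpow_natCast, ← Real.rpow_mul Real.pi_pos.le, one_div_mul_eq_div]
  field_simp

lemma setIntegral_ball_riesz (hn : 0 < n) (y : EuclideanSpace ℝ (Fin n)) {R : ℝ} (hR : 0 ≤ R) :
    ∫ x in Metric.ball y R, (‖x - y‖ ^ n)⁻¹ * ‖x - y‖ =
      R * (2 * π ^ ((n : ℝ) / 2) / Real.Gamma (n / 2)) := by
  have : Nonempty (Fin n) := ⟨⟨0, hn⟩⟩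
  have h0 : ∫ x in Metric.ball y R, (‖x - y‖ ^ n)⁻¹ * ‖x - y‖ =
      ∫ x : EuclideanSpace ℝ (Fin n), (Set.Iio R).indicator (fun t ↦ (t ^ n)⁻¹ * t) ‖x‖ := by
    rw [← integral_indicator measurableSet_ball, ← integral_sub_right_eq_self
      (fun x : EuclideanSpace ℝ (Fin n) ↦ (Set.Iio R).indicator (fun t ↦ (t ^ n)⁻¹ * t) ‖x‖) y]
    congr 1
  have h1 : ∫ t in Set.Ioi (0 : ℝ), t ^ (n - 1) • (Set.Iio R).indicator (fun t ↦ (t ^ n)⁻¹ * t) t =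
      R := by
    have h2 : ∀ t ∈ Set.Ioi (0 : ℝ), t ^ (n - 1) •
        (Set.Iio R).indicator (fun t ↦ (t ^ n)⁻¹ * t) t = (Set.Iio R).indicator 1 t := by
      intro t ht
      by_cases htR : t < R
      · obtain ⟨m, rfl⟩ := Nat.exists_eq_succ_of_ne_zero hn.ne'
        have : 0 < t := ht
        simp only [Set.indicator_apply, Set.mem_Iio, htR, if_true, Nat.succ_eq_add_one,
          Nat.add_sub_cancel, smul_eq_mul, pow_succ, Pi.one_apply]
        field_simp
      · simp [htR]
    rw [setIntegral_congr_fun measurableSet_Ioi h2, setIntegral_indicator measurableSet_Iio,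
      Set.Ioi_inter_Iio]
    simp [hR]
  rw [h0, integral_fun_norm_addHaar, finrank_euclideanSpace_fin, h1,
    ← nat_mul_volume_real_unitBall hn, nsmul_eq_mul, smul_eq_mul]
  ring

lemma integrableOn_unitBall_riesz (hn : 0 < n) (hy : ‖y‖ < 1) :
    IntegrableOn (fun x ↦ (‖x - y‖ ^ n)⁻¹ * ‖x - y‖) (Metric.ball 0 1) :=
  (integrableOn_ball_riesz hn y 2).mono_set (Metric.ball_subset_ball' (by simp; linarith))

lemma setIntegral_unitBall_riesz_le (hn : 1 < n) (hy : ‖y‖ < 1) :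
    ∫ x in Metric.ball (0 : EuclideanSpace ℝ (Fin n)) 1, (‖x - y‖ ^ n)⁻¹ * ‖x - y‖ ≤
      2 * π ^ ((n : ℝ) / 2) / Real.Gamma (n / 2) := by
  have hn0 : 0 < n := by omega
  have hI := integrableOn_unitBall_riesz hn0 hy
  have hI' := integrableOn_ball_riesz hn0 y 1
  have hc (z : EuclideanSpace ℝ (Fin n)) :
      IntegrableOn (fun _ : EuclideanSpace ℝ (Fin n) ↦ (1 : ℝ)) (Metric.ball z 1) :=
    integrableOn_const measure_ball_lt_top.ne
  have hpt (x : EuclideanSpace ℝ (Fin n)) :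
      (Metric.ball 0 1).indicator (fun x ↦ (‖x - y‖ ^ n)⁻¹ * ‖x - y‖ - 1) x ≤
      (Metric.ball y 1).indicator (fun x ↦ (‖x - y‖ ^ n)⁻¹ * ‖x - y‖ - 1) x := by
    obtain ⟨m, rfl⟩ := Nat.exists_eq_succ_of_ne_zero hn0.ne'
    have hform (hs : 0 < ‖x - y‖) :
        (‖x - y‖ ^ (m + 1))⁻¹ * ‖x - y‖ = (‖x - y‖ ^ m)⁻¹ := by
      rw [pow_succ]
      field_simp
    by_cases h1 : x ∈ Metric.ball 0 1 <;> by_cases h2 : x ∈ Metric.ball y 1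
    · simp [Set.indicator_of_mem h1, Set.indicator_of_mem h2]
    · rw [Set.indicator_of_mem h1, Set.indicator_of_notMem h2]
      rw [mem_ball_iff_norm, not_lt] at h2
      rw [hform (by linarith)]
      linarith [inv_le_one_of_one_le₀ (one_le_pow₀ h2 (n := m))]
    · rw [Set.indicator_of_notMem h1, Set.indicator_of_mem h2]
      rw [mem_ball_iff_norm] at h2
      have hs : 0 < ‖x - y‖ := norm_pos_iff.2 (sub_ne_zero.2 fun h ↦
        h1 (by rw [h]; exact mem_ball_zero_iff.2 hy))
      rw [hform hs]
      linarith [(one_le_inv₀ (pow_pos hs m)).2 (pow_le_one₀ hs.le h2.le)]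
    · simp [Set.indicator_of_notMem h1, Set.indicator_of_notMem h2]
  have hmono := integral_mono ((hI.sub (hc 0)).integrable_indicator measurableSet_ball)
    ((hI'.sub (hc y)).integrable_indicator measurableSet_ball) hpt
  rw [integral_indicator measurableSet_ball, integral_indicator measurableSet_ball] at hmono
  simp only [Pi.sub_apply] at hmono
  rw [integral_sub hI (hc 0), integral_sub hI' (hc y), setIntegral_ball_riesz hn0 y zero_le_one]
    at hmono
  have hvol : volume.real (Metric.ball y 1) =
      volume.real (Metric.ball (0 : EuclideanSpace ℝ (Fin n)) 1) := by
    simp only [Measure.real, Measure.addHaar_ball_center]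
  simp only [setIntegral_const, hvol] at hmono
  linarith

lemma integrableOn_norm_poissonGradKer (hn : 2 < n) (hy : ‖y‖ < 1) :
    IntegrableOn (fun x ↦ ‖poissonGradKer n x y‖) (Metric.ball 0 1) := by
  have : Nonempty (Fin n) := ⟨⟨0, by omega⟩⟩
  refine ((integrableOn_unitBall_riesz (by omega) hy).add (integrableOn_oddTerm hy)).mono' ?_ ?_
  · exact (Measurable.of_uncurry_right (f := poissonGradKer n)
      measurable_poissonGradKer).norm.aestronglyMeasurable
  · filter_upwards [ae_restrict_mem measurableSet_ball,
      ae_restrict_of_ae (Measure.ae_ne volume y)] with x hx hxy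
    rw [norm_norm]
    exact norm_poissonGradKer_le hn hxy (mem_ball_zero_iff.1 hx) hy

lemma setIntegral_norm_poissonGradKer_le (hn : 2 < n) (hy : ‖y‖ < 1) :
    ∫ x in Metric.ball 0 1, ‖poissonGradKer n x y‖ ≤
      2 * π ^ ((n : ℝ) / 2) / Real.Gamma (n / 2) := by
  have : Nonempty (Fin n) := ⟨⟨0, by omega⟩⟩
  have hI := integrableOn_unitBall_riesz (n := n) (by omega) hy
  calc ∫ x in Metric.ball 0 1, ‖poissonGradKer n x y‖
      ≤ ∫ x in Metric.ball 0 1, ((‖x - y‖ ^ n)⁻¹ * ‖x - y‖ + oddTerm n x y) := by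
        refine integral_mono_ae (integrableOn_norm_poissonGradKer hn hy)
          (hI.add (integrableOn_oddTerm hy)) ?_
        filter_upwards [ae_restrict_mem measurableSet_ball,
          ae_restrict_of_ae (Measure.ae_ne volume y)] with x hx hxy
        exact norm_poissonGradKer_le hn hxy (mem_ball_zero_iff.1 hx) hy
    _ ≤ _ := by
        rw [integral_add hI (integrableOn_oddTerm hy)]
        linarith [setIntegral_oddTerm_nonpos (n := n) hy,
          setIntegral_unitBall_riesz_le (n := n) (by omega) hy]

lemma le_setIntegral_norm_poissonGradKer (hn : 2 < n) (hy : ‖y‖ < 1) :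
    (1 - ‖y‖) * (2 * π ^ ((n : ℝ) / 2) / Real.Gamma (n / 2)) -
      volume.real (Metric.ball (0 : EuclideanSpace ℝ (Fin n)) 1) *
        (((1 - ‖y‖) ^ n)⁻¹ * (2 * ‖y‖)) ≤
      ∫ x in Metric.ball 0 1, ‖poissonGradKer n x y‖ := by
  have hI := integrableOn_unitBall_riesz (n := n) (by omega) hy
  have hc : IntegrableOn (fun _ : EuclideanSpace ℝ (Fin n) ↦ ((1 - ‖y‖) ^ n)⁻¹ * (2 * ‖y‖))
      (Metric.ball 0 1) := integrableOn_const measure_ball_lt_top.ne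
  have hmono := setIntegral_mono_on (hI.sub hc) (integrableOn_norm_poissonGradKer hn hy)
    measurableSet_ball fun x hx ↦ le_norm_poissonGradKer (n := n) (mem_ball_zero_iff.1 hx) hy
  simp only [Pi.sub_apply] at hmono
  rw [integral_sub hI hc, setIntegral_const, smul_eq_mul] at hmono
  have hsub : Metric.ball y (1 - ‖y‖) ⊆ Metric.ball 0 1 := Metric.ball_subset_ball' (by simp)
  have hle := setIntegral_mono_set hI (.of_forall fun x ↦ by positivity) hsub.eventuallyLE
  rw [setIntegral_ball_riesz (by omega) y (by linarith)] at hle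
  linarith

end integral_estimates

lemma integrable_poissonGradKer_mul {n : ℕ} (hn : 2 < n) {g : EuclideanSpace ℝ (Fin n) → ℝ}
    (hg : Integrable g (volume.restrict (Metric.ball 0 1))) :
    Integrable (Function.uncurry fun x y ↦ ‖poissonGradKer n x y‖ * g y)
      ((volume.restrict (Metric.ball (0 : EuclideanSpace ℝ (Fin n)) 1)).prod
        (volume.restrict (Metric.ball (0 : EuclideanSpace ℝ (Fin n)) 1))) := by
  have hmeas : AEStronglyMeasurable (Function.uncurry fun x y ↦ ‖poissonGradKer n x y‖ * g y)
      ((volume.restrict (Metric.ball (0 : EuclideanSpace ℝ (Fin n)) 1)).prod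
        (volume.restrict (Metric.ball (0 : EuclideanSpace ℝ (Fin n)) 1))) :=
    measurable_poissonGradKer.norm.aestronglyMeasurable.mul hg.aestronglyMeasurable.comp_snd
  rw [integrable_prod_iff' hmeas]
  constructor
  · filter_upwards [ae_restrict_mem measurableSet_ball] with y hy
    exact (integrableOn_norm_poissonGradKer hn (mem_ball_zero_iff.1 hy)).mul_const (g y)
  · refine (hg.norm.const_mul (2 * π ^ ((n : ℝ) / 2) / Real.Gamma (n / 2))).mono'
      hmeas.norm.prod_swap.integral_prod_right' ?_
    filter_upwards [ae_restrict_mem measurableSet_ball] with y hy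
    rw [Real.norm_of_nonneg (integral_nonneg fun _ ↦ norm_nonneg _)]
    simp only [Function.uncurry_apply_pair, norm_mul, norm_norm, integral_mul_const]
    gcongr
    exact setIntegral_norm_poissonGradKer_le hn (mem_ball_zero_iff.1 hy)

lemma setIntegral_setIntegral_poissonGradKer_mul {n : ℕ} (hn : 2 < n)
    {g : EuclideanSpace ℝ (Fin n) → ℝ} (hg : Integrable g (volume.restrict (Metric.ball 0 1))) :
    ∫ x in Metric.ball (0 : EuclideanSpace ℝ (Fin n)) 1,
        ∫ y in Metric.ball (0 : EuclideanSpace ℝ (Fin n)) 1, ‖poissonGradKer n x y‖ * g y =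
      ∫ y in Metric.ball (0 : EuclideanSpace ℝ (Fin n)) 1,
        (∫ x in Metric.ball (0 : EuclideanSpace ℝ (Fin n)) 1, ‖poissonGradKer n x y‖) * g y := by
  rw [integral_integral_swap (integrable_poissonGradKer_mul hn hg)]
  simp only [integral_mul_const]

lemma setIntegral_abs_integral_poissonGradKer_mul_le {n : ℕ} (hn : 2 < n)
    {g : EuclideanSpace ℝ (Fin n) → ℝ} (hg : Integrable g (volume.restrict (Metric.ball 0 1))) :
    ∫ x in Metric.ball (0 : EuclideanSpace ℝ (Fin n)) 1,
        |∫ y in Metric.ball (0 : EuclideanSpace ℝ (Fin n)) 1, ‖poissonGradKer n x y‖ * g y| ≤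
      2 * π ^ ((n : ℝ) / 2) / Real.Gamma (n / 2) *
        ∫ y in Metric.ball (0 : EuclideanSpace ℝ (Fin n)) 1, |g y| := by
  have hI := integrable_poissonGradKer_mul hn hg
  have hIabs := integrable_poissonGradKer_mul hn hg.abs
  calc _ ≤ ∫ x in Metric.ball (0 : EuclideanSpace ℝ (Fin n)) 1,
        ∫ y in Metric.ball (0 : EuclideanSpace ℝ (Fin n)) 1, ‖poissonGradKer n x y‖ * |g y| := by
        refine integral_mono hI.integral_prod_left.abs hIabs.integral_prod_left fun x ↦ ?_
        refine (abs_integral_le_integral_abs).trans_eq ?_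
        simp only [abs_mul, abs_norm]
    _ = ∫ y in Metric.ball (0 : EuclideanSpace ℝ (Fin n)) 1,
        (∫ x in Metric.ball (0 : EuclideanSpace ℝ (Fin n)) 1, ‖poissonGradKer n x y‖) * |g y| :=
        setIntegral_setIntegral_poissonGradKer_mul hn hg.abs
    _ ≤ _ := by
        rw [← integral_const_mul]
        refine integral_mono_ae ?_ (hg.abs.const_mul _) ?_
        · simpa only [Function.uncurry_apply_pair, integral_mul_const] using
            hIabs.integral_prod_right
        · filter_upwards [ae_restrict_mem measurableSet_ball] with y hy
          gcongr
          exact setIntegral_norm_poissonGradKer_le hn (mem_ball_zero_iff.1 hy)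

lemma exists_ball_lt_setIntegral_norm_poissonGradKer {n : ℕ} (hn : 2 < n) {a : ℝ}
    (ha : a < 2 * π ^ ((n : ℝ) / 2) / Real.Gamma (n / 2)) :
    ∃ ε > 0, ε < 1 ∧ ∀ y : EuclideanSpace ℝ (Fin n), ‖y‖ < ε →
      a < ∫ x in Metric.ball (0 : EuclideanSpace ℝ (Fin n)) 1, ‖poissonGradKer n x y‖ := by
  set ω := 2 * π ^ ((n : ℝ) / 2) / Real.Gamma (n / 2)
  set V := volume.real (Metric.ball (0 : EuclideanSpace ℝ (Fin n)) 1)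
  have hcont : ContinuousAt (fun r : ℝ ↦ (1 - r) * ω - V * (((1 - r) ^ n)⁻¹ * (2 * r))) 0 := by
    fun_prop (disch := norm_num)
  have hev := hcont.eventually (lt_mem_nhds (a := a) (by simpa using ha))
  obtain ⟨δ, hδ, h⟩ := Metric.eventually_nhds_iff.1 hev
  refine ⟨min δ (1 / 2), by positivity, by linarith [min_le_right δ (1 / 2)], fun y hy ↦ ?_⟩
  have h1 : ‖y‖ < δ := hy.trans_le (min_le_left _ _)
  have h2 : ‖y‖ < 1 := by linarith [min_le_right δ (1 / 2)]
  exact (h (by simpa using h1)).trans_le (le_setIntegral_norm_poissonGradKer hn h2)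

lemma integrableOn_setIntegral_norm_poissonGradKer {n : ℕ} (hn : 2 < n) :
    IntegrableOn (fun y : EuclideanSpace ℝ (Fin n) ↦
      ∫ x in Metric.ball (0 : EuclideanSpace ℝ (Fin n)) 1, ‖poissonGradKer n x y‖)
      (Metric.ball 0 1) := by
  have h1 : Integrable (fun _ : EuclideanSpace ℝ (Fin n) ↦ (1 : ℝ))
      (volume.restrict (Metric.ball 0 1)) := integrableOn_const measure_ball_lt_top.ne
  simpa using! (integrable_poissonGradKer_mul hn h1).integral_prod_right

/-- The operator `𝒩 g(x) = (1/((n−2)ω_{n−1})) ∫_{B^n} |(x−y)/|x−y|^n − (|y|²x−y)/[x,y]^n| g(y) dy`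
is bounded from `L¹(B^n)` to `L¹(B^n)` with operator norm exactly `1/(n−2)`, where
`ω_{n−1} = 2π^{n/2}/Γ(n/2)`. -/
theorem norm_N_l1 (n : ℕ) (hn : 2 < n) :
    IsLeast
      {c : ℝ | 0 ≤ c ∧ ∀ g : EuclideanSpace ℝ (Fin n) → ℝ,
        Integrable g (volume.restrict (Metric.ball (0 : EuclideanSpace ℝ (Fin n)) 1)) →
        (∫ x in Metric.ball (0 : EuclideanSpace ℝ (Fin n)) 1,
            |(((n : ℝ) - 2) * (2 * π ^ ((n : ℝ) / 2) / Real.Gamma (n / 2)))⁻¹ *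
              ∫ y in Metric.ball (0 : EuclideanSpace ℝ (Fin n)) 1,
                ‖poissonGradKer n x y‖ * g y|) ≤
          c * ∫ y in Metric.ball (0 : EuclideanSpace ℝ (Fin n)) 1, |g y|}
      (1 / ((n : ℝ) - 2)) := by
  have hn2 : (0 : ℝ) < (n : ℝ) - 2 := by
    have : (2 : ℝ) < n := by exact_mod_cast hn
    linarith
  have hω : 0 < 2 * π ^ ((n : ℝ) / 2) / Real.Gamma (n / 2) := by
    have := Real.Gamma_pos_of_pos (s := (n : ℝ) / 2) (by linarith)
    positivity
  set ω := 2 * π ^ ((n : ℝ) / 2) / Real.Gamma (n / 2)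
  refine ⟨⟨by positivity, fun g hg ↦ ?_⟩, ?_⟩
  · simp only [abs_mul, integral_const_mul]
    rw [abs_of_pos (by positivity : 0 < (((n : ℝ) - 2) * ω)⁻¹)]
    calc _ ≤ (((n : ℝ) - 2) * ω)⁻¹ * (ω * ∫ y in Metric.ball 0 1, |g y|) := by
          gcongr
          exact setIntegral_abs_integral_poissonGradKer_mul_le hn hg
      _ = _ := by field_simp
  · rintro c ⟨-, hc⟩
    by_contra! hlt
    have hlt' : c * (((n : ℝ) - 2) * ω) < ω := by
      rw [lt_div_iff₀ hn2] at hlt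
      nlinarith
    obtain ⟨a, hca, haω⟩ := exists_between hlt'
    obtain ⟨ε, hε, hε1, hball⟩ := exists_ball_lt_setIntegral_norm_poissonGradKer hn haω
    have hsub : Metric.ball (0 : EuclideanSpace ℝ (Fin n)) ε ⊆ Metric.ball 0 1 :=
      Metric.ball_subset_ball hε1.le
    set g : EuclideanSpace ℝ (Fin n) → ℝ := (Metric.ball 0 ε).indicator 1 with hgdef
    have hg0 (y) : 0 ≤ g y := Set.indicator_nonneg (fun _ _ ↦ zero_le_one) y
    have hg : Integrable g (volume.restrict (Metric.ball 0 1)) :=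
      (integrable_indicator_iff measurableSet_ball).2
        (integrableOn_const (measure_ball_lt_top.ne)).restrict
    have habs (x) : |∫ y in Metric.ball 0 1, ‖poissonGradKer n x y‖ * g y| =
        ∫ y in Metric.ball 0 1, ‖poissonGradKer n x y‖ * g y :=
      abs_of_nonneg (integral_nonneg fun y ↦ mul_nonneg (norm_nonneg _) (hg0 y))
    have h1 := hc g hg
    simp only [abs_mul, integral_const_mul, abs_of_nonneg (hg0 _), habs] at h1
    rw [abs_of_pos (by positivity : 0 < (((n : ℝ) - 2) * ω)⁻¹),
      setIntegral_setIntegral_poissonGradKer_mul hn hg, inv_mul_le_iff₀ (by positivity)] at h1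
    have hind (f : EuclideanSpace ℝ (Fin n) → ℝ) :
        ∫ y in Metric.ball 0 1, f y * g y = ∫ y in Metric.ball 0 ε, f y := by
      have : (fun y ↦ f y * g y) = (Metric.ball 0 ε).indicator f := by
        ext y
        by_cases h : y ∈ Metric.ball 0 ε <;> simp only [hgdef, Set.indicator_of_mem, h,
          Set.indicator_of_notMem, not_false_eq_true, Pi.one_apply, mul_one, mul_zero]
      rw [this, setIntegral_indicator measurableSet_ball, Set.inter_eq_right.2 hsub]
    have hIg : ∫ y in Metric.ball 0 1, g y =
        volume.real (Metric.ball (0 : EuclideanSpace ℝ (Fin n)) ε) := by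
      simpa using hind 1
    rw [hind, hIg] at h1
    have hvol : 0 < volume.real (Metric.ball (0 : EuclideanSpace ℝ (Fin n)) ε) :=
      ENNReal.toReal_pos (Metric.measure_ball_pos volume _ hε).ne' measure_ball_lt_top.ne
    have h2 := setIntegral_mono_on (f := fun _ ↦ a)
      (integrableOn_const (measure_ball_lt_top (μ := volume)).ne)
      ((integrableOn_setIntegral_norm_poissonGradKer hn).mono_set hsub) measurableSet_ball
      fun y hy ↦ (hball y (mem_ball_zero_iff.1 hy)).le
    rw [setIntegral_const, smul_eq_mul] at h2
    nlinarith [mul_lt_mul_of_pos_left hca hvol]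
end
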